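/- Fix integers r ≥ 2 and n ≥ 1. For a partition λ of n and a partition μ of rn with empty r-core, set ℓ_{λμ} = δ_r(μ)·LR^λ_{μ[0],…,μ[r−1]}. Then for every partition λ of n and every partition ρ of rn that is not of the form rσ for a partition σ of n (i.e. not all parts of ρ are divisible by r with ρ/r a partition of n), one has Σ_μ ℓ_{λμ}·χ^μ(ρ) = 0, where the sum runs over all partitions μ of rn with empty r-core. -/

import Mathlib

open scoped BigOperators

/-- A partition, represented canonically as the multiset of its (positive) parts. -/
structure Ptn where
  parts : Multiset ℕ
  pos : ∀ x ∈ parts, 0 < x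

namespace Ptn

/-- Build a partition from an arbitrary multiset of naturals by discarding zero parts. -/
def of (s : Multiset ℕ) : Ptn :=
  ⟨s.filter (fun x => 0 < x), fun _ hx => (Multiset.mem_filter.mp hx).2⟩

/-- The empty partition. -/
def empty : Ptn := ⟨0, by simp⟩

/-- The `i`-th largest part (`0`-indexed); `0` if `i` is at least the number of parts. -/
def part (l : Ptn) (i : ℕ) : ℕ :=
  ((l.parts.sort (· ≤ ·)).reverse).getD i 0

/-- The number of (positive) parts. -/
def length (l : Ptn) : ℕ := Multiset.card l.parts

/-- The size `|λ|`, i.e. the number being partitioned. -/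
def size (l : Ptn) : ℕ := l.parts.sum

/-- A partition is strict if all its parts are distinct. -/
def Strict (l : Ptn) : Prop := l.parts.Nodup

/-- The conjugate partition. -/
def conj (l : Ptn) : Ptn :=
  of ((Multiset.range (l.part 0)).map
    (fun j => Multiset.card (l.parts.filter (fun x => j < x))))

end Ptn

/-- The rectangular partition `□(n,m)` with `n` rows of length `m`. -/
def rect (n m : ℕ) : Ptn := Ptn.of (Multiset.replicate n m)

/-- The partition obtained by multiplying every part by `r`. -/
def scaleP (r : ℕ) (l : Ptn) : Ptn := Ptn.of (l.parts.map (fun a => r * a))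

/-- Diagram containment: every part of `small` is at most the corresponding part of `big`. -/
def Contains (big small : Ptn) : Prop := ∀ i, small.part i ≤ big.part i

/-- The beta-set (first-column hook lengths) `{λ_i + m - 1 - i : i < m}` of `l`,
computed with `m` beads (`m` at least the number of parts). -/
def betaSet (l : Ptn) (m : ℕ) : Finset ℕ :=
  (Finset.range m).image (fun i => l.part i + (m - 1 - i))

/-- The partition encoded by a finite set of bead positions: each bead contributes a part
equal to the number of empty positions (holes) below it. -/
def ptnOfBeads (B : Finset ℕ) : Ptn :=
  Ptn.of (B.val.map (fun p => p - (B.filter (fun q => q < p)).card))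

/-- Levels of the beads on runner `k` of the `r`-abacus of `l`,
drawn with `r * l.length` beads (a multiple of `r`). -/
def runnerLevels (r : ℕ) (l : Ptn) (k : ℕ) : Finset ℕ :=
  (Finset.range (l.part 0 + r * l.length + 1)).filter
    (fun s => r * s + k ∈ betaSet l (r * l.length))

/-- The `k`-th component `λ[k]` of the `r`-quotient of `l`. -/
def quotP (r : ℕ) (l : Ptn) (k : ℕ) : Ptn := ptnOfBeads (runnerLevels r l k)

/-- The `r`-core of `l`: push all beads of the `r`-abacus down as far as possible. -/
def coreP (r : ℕ) (l : Ptn) : Ptn :=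
  ptnOfBeads ((Finset.range r).biUnion
    (fun k => (Finset.range (runnerLevels r l k).card).image (fun s => r * s + k)))

/-- The key of the bead at position `p` for the `r`-numbering of the beads `B`:
a bead which is the `j`-th lowest bead on runner `k` gets key `r * j + k`. -/
def rKey (r : ℕ) (B : Finset ℕ) (p : ℕ) : ℕ :=
  r * (B.filter (fun q => q % r = p % r ∧ q < p)).card + p % r

/-- The number of inversions between the natural (increasing-position) numbering of the
beads `B` and the numbering by increasing `key`. -/
def inversions (key : ℕ → ℕ) (B : Finset ℕ) : ℕ :=
  ((B ×ˢ B).filter (fun pq => pq.1 < pq.2 ∧ key pq.2 < key pq.1)).card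

/-- Exponent of the `r`-sign `δ_r`. -/
def rSignExp (r : ℕ) (l : Ptn) : ℕ :=
  inversions (rKey r (betaSet l (r * l.length))) (betaSet l (r * l.length))

/-- The `r`-sign `δ_r(λ) ∈ {±1}`. -/
def rSign (r : ℕ) (l : Ptn) : ℤ := (-1) ^ rSignExp r l

/-- The key of the bead at position `p` for the `3`-bar numbering of the beads `B` of the
`3`-bar abacus: first the beads of runner `0` in increasing order, then the pairs of beads
on runners `2` and `1` paired off by increasing level (runner-`2` bead before
runner-`1` bead), then the remaining unpaired beads in increasing order. -/
def barKey (B : Finset ℕ) (p : ℕ) : ℕ :=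
  let n0 := (B.filter (fun q => q % 3 = 0)).card
  let t := min ((B.filter (fun q => q % 3 = 1)).card)
              ((B.filter (fun q => q % 3 = 2)).card)
  let rk := (B.filter (fun q => q % 3 = p % 3 ∧ q < p)).card
  if p % 3 = 0 then rk
  else if rk < t then (if p % 3 = 2 then n0 + 2 * rk else n0 + 2 * rk + 1)
  else n0 + 2 * t + (rk - t)

/-- Exponent of the `3`-bar sign `δ̄_3`.  The beads of the `3`-bar abacus of a strict
partition sit at the positions given by the parts. -/
def barSignExp (l : Ptn) : ℕ :=
  inversions (barKey l.parts.toFinset) l.parts.toFinset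

/-- The `3`-bar sign `δ̄_3(λ) ∈ {±1}` of a strict partition. -/
def barSign3 (l : Ptn) : ℤ := (-1) ^ barSignExp l

/-- The double `D(λ) = (λ_1,…,λ_l | λ_1 - 1,…,λ_l - 1)` (Frobenius notation)
of a strict partition `λ`, constructed row by row. -/
noncomputable def double (l : Ptn) : Ptn :=
  Ptn.of ((Multiset.range (l.length + l.part 0)).map (fun i =>
    (if i < l.length then l.part i + 1 else 0) +
      ((Finset.range (min i l.length)).filter (fun j => i + 1 ≤ j + l.part j)).card))

/-- The second component `λ^b[1] = D(λ)[1]` of the `3`-bar quotient of a strict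
partition `λ`. -/
noncomputable def barQuot1 (l : Ptn) : Ptn := quotP 3 (double l) 1

/-- The staircase-like strict partition `Λ_ℓ = (3ℓ-2, 3ℓ-5, …, 7, 4, 1)`. -/
def LamP (ℓ : ℕ) : Ptn := Ptn.of ((Multiset.range ℓ).map (fun i => 3 * i + 1))

/-- The staircase partition `Δ_ℓ = (ℓ, ℓ-1, …, 1)`. -/
def DelP (ℓ : ℕ) : Ptn := Ptn.of (Multiset.range (ℓ + 1))

/-- `F_1^m(Λ_ℓ)`: strict partitions obtained from `Λ_ℓ` by adding `m` cells, each
labelled `1`, where the cell in (0-indexed) column `j` is labelled `1` iff `j % 3 = 1`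
(each row reads `0,1,0,0,1,0,…`). -/
def F1Lam (ℓ m : ℕ) : Set Ptn :=
  {mu | mu.Strict ∧ Contains mu (LamP ℓ) ∧ mu.size = (LamP ℓ).size + m ∧
    ∀ i j, (LamP ℓ).part i ≤ j → j < mu.part i → j % 3 = 1}

/-- `F_1^m(Δ_ℓ)`: partitions obtained from `Δ_ℓ` by adding `m` cells, each labelled `1`,
where the cell `(i,j)` is labelled `1` iff `i + j` is odd. -/
def F1Del (ℓ m : ℕ) : Set Ptn :=
  {mu | Contains mu (DelP ℓ) ∧ mu.size = (DelP ℓ).size + m ∧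
    ∀ i j, (DelP ℓ).part i ≤ j → j < mu.part i → (i + j) % 2 = 1}

/-- `(α, β)` is complementary relative to the rectangle `□(n,m)`:
`α ⊆ □(n,m)` and `β_i = m - α_{n+1-i}` for `1 ≤ i ≤ n` (0-indexed below). -/
def Complementary (n m : ℕ) (a b : Ptn) : Prop :=
  a.length ≤ n ∧ a.part 0 ≤ m ∧ b.length ≤ n ∧
    ∀ i < n, b.part i = m - a.part (n - 1 - i)

/-- `W(n,m)`: the set of `(n,m)`-balanced partitions, i.e. partitions of `2nm` with at
most `2n` parts satisfying `μ_i + μ_{2n+1-i} = 2m` for `1 ≤ i ≤ n` (0-indexed below). -/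
def W (n m : ℕ) : Set Ptn :=
  {mu | mu.size = 2 * n * m ∧ mu.length ≤ 2 * n ∧
    ∀ i < n, mu.part i + mu.part (2 * n - 1 - i) = 2 * m}

/-! ### The ring of symmetric functions

We realise the ring of symmetric functions (with rational coefficients) as the
polynomial ring `ℚ[p_1, p_2, …]` in the power sums: the variable `X n` of
`MvPolynomial ℕ ℚ` stands for the power sum `p_{n+1}`. -/

abbrev SymF := MvPolynomial ℕ ℚ

open MvPolynomial

/-- `z_ρ = ∏ a^{m_a} m_a!` for a partition given as a multiset `ρ`. -/
def zval (s : Multiset ℕ) : ℚ :=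
  s.toFinset.prod (fun a => (a : ℚ) ^ s.count a * (Nat.factorial (s.count a) : ℚ))

/-- The power sum product `p_ρ` of a multiset `ρ`. -/
noncomputable def pMult (s : Multiset ℕ) : SymF :=
  (s.map (fun a => (X (a - 1) : SymF))).prod

/-- The complete homogeneous symmetric function `h_n = Σ_{ρ ⊢ n} z_ρ⁻¹ p_ρ`. -/
noncomputable def hSym (n : ℕ) : SymF :=
  ∑ ρ : Nat.Partition n, (zval ρ.parts)⁻¹ • pMult ρ.parts

/-- `h_k` for an integer index, vanishing for negative `k`. -/
noncomputable def hz (k : ℤ) : SymF := if k < 0 then 0 else hSym k.toNat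

/-- The Schur function `S_λ`, via the Jacobi–Trudi formula
`S_λ = det(h_{λ_i - i + j})`. -/
noncomputable def schur (l : Ptn) : SymF :=
  Matrix.det (Matrix.of (fun i j : Fin l.length =>
    hz ((l.part i.val : ℤ) + (j.val : ℤ) - (i.val : ℤ))))

/-- The plethysm `p_r ∘ f`: the algebra endomorphism sending each power sum `p_k`
to `p_{rk}`, i.e. substituting `x_i^r` for each variable `x_i`. -/
noncomputable def pleth (r : ℕ) (f : SymF) : SymF :=
  MvPolynomial.aeval (fun n => (X (r * (n + 1) - 1) : SymF)) f

/-- The `z`-weight of a power-sum monomial (exponent vector `d`). -/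
def zfac (d : ℕ →₀ ℕ) : ℚ :=
  d.prod (fun i e => ((i : ℚ) + 1) ^ e * (Nat.factorial e : ℚ))

/-- The Hall inner product, for which `⟨p_ρ, p_σ⟩ = δ_{ρσ} z_ρ` and the Schur
functions are orthonormal. -/
noncomputable def hall (f g : SymF) : ℚ :=
  f.support.sum (fun d => f.coeff d * g.coeff d * zfac d)

/-- The multi-Littlewood–Richardson coefficient `LR^λ_{μ^0,…,μ^{r-1}}`:
the multiplicity of `S_λ` in `S_{μ^0} ⋯ S_{μ^{r-1}}`. -/
noncomputable def LRmulti (lam : Ptn) (r : ℕ) (q : ℕ → Ptn) : ℚ :=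
  hall ((Finset.range r).prod (fun k => schur (q k))) (schur lam)

/-- The Littlewood–Richardson coefficient `LR^λ_{α,β}`:
the multiplicity of `S_λ` in `S_α · S_β`. -/
noncomputable def LR2 (lam a b : Ptn) : ℚ := hall (schur a * schur b) (schur lam)

/-- The irreducible symmetric group character `χ^μ(ρ)`, via the Frobenius formula
`χ^μ_ρ = ⟨S_μ, p_ρ⟩`. -/
noncomputable def chi (mu rho : Ptn) : ℚ := hall (schur mu) (pMult rho.parts)

/-- Symmetric functions in two alphabets `u`, `v`: `X (inl n)` is `p_{n+1}(u)` and
`X (inr n)` is `p_{n+1}(v)`. -/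
abbrev SymF2 := MvPolynomial (ℕ ⊕ ℕ) ℚ

/-- `f ↦ f(u)`. -/
noncomputable def toU : SymF →ₐ[ℚ] SymF2 :=
  aeval (fun n => (X (Sum.inl n) : SymF2))

/-- `f ↦ f(v)`. -/
noncomputable def toV : SymF →ₐ[ℚ] SymF2 :=
  aeval (fun n => (X (Sum.inr n) : SymF2))

/-- `f ↦ f(u - v)`, the difference of alphabets: `p_k ↦ p_k(u) - p_k(v)`. -/
noncomputable def toUV : SymF →ₐ[ℚ] SymF2 :=
  aeval (fun n => (X (Sum.inl n) : SymF2) - X (Sum.inr n))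

/-! ### The Hall inner product -/

theorem hall_eq_sum {f : SymF} (g : SymF) {s : Finset (ℕ →₀ ℕ)} (hs : f.support ⊆ s) :
    hall f g = ∑ d ∈ s, f.coeff d * g.coeff d * zfac d :=
  Finset.sum_subset hs fun d _ hd => by simp [notMem_support_iff.mp hd]

/-- The Hall inner product as a linear functional of its first argument. -/
noncomputable def hallLeft (g : SymF) : SymF →ₗ[ℚ] ℚ where
  toFun f := hall f g
  map_add' f f' := by
    classical
    rw [hall_eq_sum (f := f) g (s := f.support ∪ (f'.support ∪ (f + f').support))
        (fun x => by simp +contextual),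
      hall_eq_sum (f := f') g (s := f.support ∪ (f'.support ∪ (f + f').support))
        (fun x => by simp +contextual),
      hall_eq_sum (f := f + f') g (s := f.support ∪ (f'.support ∪ (f + f').support))
        (fun x => by simp +contextual), ← Finset.sum_add_distrib]
    exact Finset.sum_congr rfl fun d _ => by rw [coeff_add]; ring
  map_smul' c f := by
    rw [hall_eq_sum g (support_smul (a := c) (f := f)), hall, RingHom.id_apply, smul_eq_mul,
      Finset.mul_sum]
    exact Finset.sum_congr rfl fun d _ => by rw [coeff_smul, smul_eq_mul]; ring

theorem hallLeft_apply (f g : SymF) : hallLeft g f = hall f g := rfl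

theorem hallLeft_monomial (g : SymF) (d : ℕ →₀ ℕ) (c : ℚ) :
    hallLeft g (monomial d c) = c * g.coeff d * zfac d := by
  classical
  rw [hallLeft_apply, hall_eq_sum g (support_monomial_subset)]
  simp

theorem zfac_add_single (d : ℕ →₀ ℕ) (i : ℕ) :
    zfac (d + Finsupp.single i 1) = zfac d * ((i + 1 : ℚ) * (d i + 1)) := by
  classical
  have h (e : ℕ →₀ ℕ) : zfac e = (((e.erase i).prod
      fun j a => ((j : ℚ) + 1) ^ a * (Nat.factorial a : ℚ))) *
        (((i : ℚ) + 1) ^ e i * (Nat.factorial (e i) : ℚ)) := by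
    rw [zfac, mul_comm]
    exact (Finsupp.mul_prod_erase' e i (fun j a => ((j : ℚ) + 1) ^ a * (Nat.factorial a : ℚ))
      (by simp)).symm
  rw [h, h d]
  have : (d + Finsupp.single i 1).erase i = d.erase i := by
    ext j
    by_cases hj : j = i
    · simp [hj]
    · simp [Finsupp.erase_ne hj]
  rw [this]
  simp [Nat.factorial_succ, pow_succ]
  ring

/-- The derivation `k ∂/∂p_k`, with `k = i + 1`: the adjoint of multiplication by `p_k`. -/
noncomputable def skewPower (i : ℕ) : Derivation ℚ SymF SymF := ((i : ℚ) + 1) • pderiv i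

theorem skewPower_apply (i : ℕ) (f : SymF) : skewPower i f = ((i : ℚ) + 1) • pderiv i f := rfl

theorem skewPower_X (i j : ℕ) :
    skewPower i (X j) = if i = j then C ((i : ℚ) + 1) else 0 := by
  rw [skewPower_apply]
  split_ifs with h
  · rw [h, pderiv_X_self, smul_eq_C_mul, mul_one]
  · rw [pderiv_X_of_ne (Ne.symm h), smul_zero]

theorem exists_eq_add_single {d : ℕ →₀ ℕ} {i : ℕ} (hd : i ∈ d.support) :
    ∃ e, d = e + Finsupp.single i 1 := by
  refine ⟨d - Finsupp.single i 1, (tsub_add_cancel_of_le ?_).symm⟩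
  rw [Finsupp.single_le_iff]
  exact Nat.one_le_iff_ne_zero.mpr (Finsupp.mem_support_iff.mp hd)

theorem hall_X_mul (i : ℕ) (f g : SymF) : hall f (X i * g) = hall (skewPower i f) g := by
  classical
  simp only [← hallLeft_apply]
  induction f using MvPolynomial.induction_on' with
  | add f f' hf hf' => rw [map_add, hf, hf', map_add, map_add]
  | monomial d c =>
    simp only [skewPower_apply, pderiv_monomial, map_smul, hallLeft_monomial, coeff_X_mul',
      smul_eq_mul]
    by_cases hd : i ∈ d.support
    · obtain ⟨e, rfl⟩ := exists_eq_add_single hd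
      rw [if_pos hd, add_tsub_cancel_right, zfac_add_single]
      simp
      ring
    · rw [if_neg hd]
      simp [Finsupp.notMem_support_iff.mp hd]

/-- A polynomial is determined by its partial derivatives and its constant term. -/
theorem eq_of_skewPower_eq {f g : SymF} (h : ∀ i, skewPower i f = skewPower i g)
    (h0 : constantCoeff f = constantCoeff g) : f = g := by
  classical
  ext d
  by_cases hd : d = 0
  · rw [hd]; exact h0
  obtain ⟨i, hi⟩ := Finsupp.support_nonempty_iff.mpr hd
  obtain ⟨e, rfl⟩ := exists_eq_add_single hi
  have := congrArg (coeff e) (h i)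
  simp only [skewPower_apply, coeff_smul, coeff_pderiv, smul_eq_mul] at this
  have h1 : ((i : ℚ) + 1) ≠ 0 := by positivity
  have h2 : ((e i : ℚ) + 1) ≠ 0 := by positivity
  exact mul_right_cancel₀ h2 (mul_left_cancel₀ h1 this)

/-! ### Derivatives of the complete homogeneous functions -/

theorem zval_cons (a : ℕ) (s : Multiset ℕ) :
    zval (a ::ₘ s) = zval s * (a * (s.count a + 1)) := by
  classical
  have h (t : Multiset ℕ) (ht : t ⊆ a ::ₘ s) : zval t =
      (∏ b ∈ (a ::ₘ s).toFinset.erase a, (b : ℚ) ^ t.count b * (Nat.factorial (t.count b) : ℚ)) *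
        ((a : ℚ) ^ t.count a * (Nat.factorial (t.count a) : ℚ)) := by
    rw [zval, Finset.prod_erase_mul _ _ (by simp)]
    refine Finset.prod_subset (fun x hx => ?_) fun x _ hx => ?_
    · exact Multiset.mem_toFinset.mpr (ht (Multiset.mem_toFinset.mp hx))
    · rw [Multiset.mem_toFinset] at hx
      simp [Multiset.count_eq_zero_of_notMem hx]
  rw [h _ (Multiset.Subset.refl _), h s (Multiset.subset_cons s a), Multiset.count_cons_self]
  have : ∀ b ∈ (a ::ₘ s).toFinset.erase a, (a ::ₘ s).count b = s.count b := fun b hb =>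
    Multiset.count_cons_of_ne (Finset.ne_of_mem_erase hb) s
  rw [Finset.prod_congr rfl fun b hb => by rw [this b hb]]
  simp [Nat.factorial_succ, pow_succ]
  ring

theorem skewPower_pMult (i : ℕ) (s : Multiset ℕ) (hs : ∀ a ∈ s, 0 < a) :
    skewPower i (pMult s) = (((i : ℚ) + 1) * s.count (i + 1)) • pMult (s.erase (i + 1)) := by
  classical
  induction s using Multiset.induction_on with
  | empty => simp [pMult]
  | cons a s ih =>
    have ih := ih fun b hb => hs b (Multiset.mem_cons_of_mem hb)
    have ha := hs a (Multiset.mem_cons_self a s)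
    have hc (t : Multiset ℕ) (b : ℕ) : pMult (b ::ₘ t) = X (b - 1) * pMult t := by simp [pMult]
    rw [hc, Derivation.leibniz, ih, skewPower_X]
    by_cases h : i + 1 = a
    · subst h
      simp only [add_tsub_cancel_right, if_true, smul_eq_mul, Multiset.erase_cons_head,
        Multiset.count_cons_self]
      by_cases hm : i + 1 ∈ s
      · have hX : X i * pMult (s.erase (i + 1)) = pMult s := by
          conv_rhs => rw [← Multiset.cons_erase hm, hc]
          simp
        rw [mul_smul_comm, hX, smul_eq_C_mul, smul_eq_C_mul, mul_comm (pMult s), ← add_mul, ← C_add]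
        push_cast
        ring_nf
      · simp [Multiset.count_eq_zero_of_notMem hm, smul_eq_C_mul]
        ring
    · rw [if_neg (by omega), Multiset.erase_cons_tail s (Ne.symm h), hc,
        Multiset.count_cons_of_ne h, smul_zero, add_zero, smul_eq_mul, mul_smul_comm]

theorem zval_ne_zero {s : Multiset ℕ} (hs : ∀ a ∈ s, 0 < a) : zval s ≠ 0 := by
  refine Finset.prod_ne_zero_iff.mpr fun a ha => ?_
  have := hs a (Multiset.mem_toFinset.mp ha)
  positivity

theorem skewPower_hSym (i n : ℕ) :
    skewPower i (hSym n) = if i + 1 ≤ n then hSym (n - (i + 1)) else 0 := by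
  classical
  have hterm (ρ : Nat.Partition n) : skewPower i ((zval ρ.parts)⁻¹ • pMult ρ.parts) =
      if i + 1 ∈ ρ.parts then
        (zval (ρ.parts.erase (i + 1)))⁻¹ • pMult (ρ.parts.erase (i + 1)) else 0 := by
    rw [Derivation.map_smul, skewPower_pMult i _ fun a ha => ρ.parts_pos ha]
    split_ifs with h
    · rw [smul_smul]
      congr 1
      have hz := zval_cons (i + 1) (ρ.parts.erase (i + 1))
      have hne := zval_ne_zero (s := ρ.parts.erase (i + 1))
        fun a ha => ρ.parts_pos (Multiset.mem_of_mem_erase ha)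
      rw [Multiset.cons_erase h] at hz
      have hcount : (ρ.parts.count (i + 1) : ℚ) = (ρ.parts.erase (i + 1)).count (i + 1) + 1 := by
        conv_lhs => rw [← Multiset.cons_erase h]
        simp
      rw [hz, hcount]
      push_cast
      field_simp
    · simp [Multiset.count_eq_zero_of_notMem h]
  rw [hSym, map_sum, Finset.sum_congr rfl fun ρ _ => hterm ρ, ← Finset.sum_filter]
  split_ifs with h
  · symm
    refine Finset.sum_bij (fun (ρ : Nat.Partition (n - (i + 1))) _ =>
      (⟨(i + 1) ::ₘ ρ.parts, fun {a} ha => ?_, ?_⟩ : Nat.Partition n)) ?_ ?_ ?_ ?_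
    · rcases Multiset.mem_cons.mp ha with rfl | ha
      · exact Nat.succ_pos i
      · exact ρ.parts_pos ha
    · rw [Multiset.sum_cons, ρ.parts_sum]; omega
    · simp
    · intro ρ _ σ _ hρσ
      have := congrArg Nat.Partition.parts hρσ
      simp only [Multiset.cons_inj_right] at this
      exact Nat.Partition.ext this
    · intro ρ hρ
      have hρ : i + 1 ∈ ρ.parts := by simpa using hρ
      refine ⟨⟨ρ.parts.erase (i + 1), fun ha => ρ.parts_pos (Multiset.mem_of_mem_erase ha), ?_⟩,
        Finset.mem_univ _, Nat.Partition.ext (Multiset.cons_erase hρ)⟩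
      have := congrArg Multiset.sum (Multiset.cons_erase hρ)
      rw [Multiset.sum_cons, ρ.parts_sum] at this
      omega
    · intro ρ _
      simp
  · refine Finset.sum_eq_zero fun ρ hρ => absurd ?_ h
    rw [← ρ.parts_sum]
    exact Multiset.le_sum_of_mem (Finset.mem_filter.mp hρ).2

theorem constantCoeff_hSym (n : ℕ) : constantCoeff (hSym n) = if n = 0 then 1 else 0 := by
  split_ifs with h
  · subst h
    rw [hSym, Fintype.sum_subsingleton _ default]
    simp [zval, pMult]
  · rw [hSym, map_sum]
    refine Finset.sum_eq_zero fun ρ _ => ?_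
    obtain ⟨a, ha⟩ : ∃ a, a ∈ ρ.parts := by
      refine Multiset.exists_mem_of_ne_zero fun h0 => h ?_
      rw [← ρ.parts_sum, h0, Multiset.sum_zero]
    rw [smul_eq_C_mul, map_mul, pMult, map_multiset_prod, Multiset.map_map,
      Multiset.prod_eq_zero (s := Multiset.map _ ρ.parts), mul_zero]
    exact Multiset.mem_map.mpr ⟨a, ha, by simp⟩

theorem hz_natCast (n : ℕ) : hz (n : ℤ) = hSym n := by simp [hz]

theorem hz_of_neg {z : ℤ} (h : z < 0) : hz z = 0 := if_pos h

theorem hz_zero : hz 0 = 1 := by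
  rw [hz, if_neg (lt_irrefl 0), Int.toNat_zero]
  refine eq_of_skewPower_eq (fun i => ?_) ?_
  · rw [skewPower_hSym, if_neg (by omega), Derivation.map_one_eq_zero]
  · rw [constantCoeff_hSym, if_pos rfl, map_one]

theorem skewPower_hz (i : ℕ) (z : ℤ) : skewPower i (hz z) = hz (z - (i + 1)) := by
  rcases lt_or_ge z 0 with h | h
  · rw [hz_of_neg h, hz_of_neg (by omega), map_zero]
  · lift z to ℕ using h
    rw [hz_natCast, skewPower_hSym]
    split_ifs with h
    · rw [← hz_natCast]
      push_cast [h]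
      rfl
    · rw [hz_of_neg (by omega)]

theorem constantCoeff_hz (z : ℤ) : constantCoeff (hz z) = if z = 0 then 1 else 0 := by
  rcases lt_or_ge z 0 with h | h
  · rw [hz_of_neg h, if_neg h.ne, map_zero]
  · lift z to ℕ using h
    rw [hz_natCast, constantCoeff_hSym]
    simp

/-! ### Jacobi–Trudi determinants of arbitrary integer vectors -/

theorem derivation_prod {R A ι : Type*} [CommRing R] [CommRing A] [Algebra R A] [DecidableEq ι]
    (D : Derivation R A A) (s : Finset ι) (f : ι → A) :
    D (∏ i ∈ s, f i) = ∑ l ∈ s, D (f l) * ∏ i ∈ s.erase l, f i := by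
  induction s using Finset.induction_on with
  | empty => simp
  | insert a s ha ih =>
    rw [Finset.prod_insert ha, Derivation.leibniz, ih, Finset.sum_insert ha,
      Finset.erase_insert ha, smul_eq_mul, smul_eq_mul, Finset.mul_sum, add_comm, mul_comm]
    congr 1
    refine Finset.sum_congr rfl fun l hl => ?_
    have hne : a ≠ l := fun h => ha (h ▸ hl)
    rw [Finset.erase_insert_of_ne hne,
      Finset.prod_insert fun h => ha (Finset.mem_of_mem_erase h)]
    ring

theorem derivation_det {R A ι : Type*} [CommRing R] [CommRing A] [Algebra R A] [DecidableEq ι]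
    [Fintype ι] (D : Derivation R A A) (M : Matrix ι ι A) :
    D M.det = ∑ l, (M.updateRow l fun j => D (M l j)).det := by
  have hdet (N : Matrix ι ι A) :
      N.det = ∑ σ : Equiv.Perm ι, ((Equiv.Perm.sign σ : ℤ) : A) * ∏ i, N i (σ i) := by
    rw [← Matrix.det_transpose, Matrix.det_apply']
    rfl
  simp_rw [hdet]
  rw [Finset.sum_comm, map_sum]
  refine Finset.sum_congr rfl fun σ _ => ?_
  rw [Derivation.leibniz, Derivation.map_intCast, smul_zero, add_zero, derivation_prod,
    smul_eq_mul, Finset.mul_sum]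
  refine Finset.sum_congr rfl fun l _ => ?_
  rw [← Finset.mul_prod_erase Finset.univ _ (Finset.mem_univ l), Matrix.updateRow_self]
  congr 2
  refine Finset.prod_congr rfl fun i hi => ?_
  rw [Matrix.updateRow_ne (Finset.ne_of_mem_erase hi)]

/-- The determinant `det(h_{ξ_i - j})`; for `ξ` the increasing list of beads of `λ` it is `S_λ`. -/
noncomputable def hDet {m : ℕ} (ξ : Fin m → ℤ) : SymF :=
  Matrix.det (Matrix.of fun i j : Fin m => hz (ξ i - (j.val : ℤ)))

theorem hDet_comp_perm {m : ℕ} (ξ : Fin m → ℤ) (σ : Equiv.Perm (Fin m)) :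
    hDet (ξ ∘ σ) = ((Equiv.Perm.sign σ : ℤ) : SymF) * hDet ξ :=
  Matrix.det_permute σ (Matrix.of fun i j : Fin m => hz (ξ i - (j.val : ℤ)))

theorem hDet_of_eq {m : ℕ} {ξ : Fin m → ℤ} {i j : Fin m} (hij : i ≠ j) (h : ξ i = ξ j) :
    hDet ξ = 0 :=
  Matrix.det_zero_of_row_eq hij (funext fun c => by simp [h])

theorem hDet_of_neg {m : ℕ} {ξ : Fin m → ℤ} {i : Fin m} (h : ξ i < 0) : hDet ξ = 0 :=
  Matrix.det_eq_zero_of_row_eq_zero i fun j => hz_of_neg (by omega)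

theorem skewPower_hDet {m : ℕ} (i : ℕ) (ξ : Fin m → ℤ) :
    skewPower i (hDet ξ) = ∑ l, hDet (ξ - Pi.single l ((i : ℤ) + 1)) := by
  rw [hDet, derivation_det]
  refine Finset.sum_congr rfl fun l _ => congrArg Matrix.det ?_
  ext a b : 1
  by_cases h : a = l
  · subst h
    simp only [Matrix.updateRow_self, Matrix.of_apply, skewPower_hz, Pi.sub_apply, Pi.single_eq_same]
    rw [sub_right_comm]
  · simp [h]

theorem constantCoeff_hDet {m : ℕ} {ξ : Fin m → ℤ} (h : ∑ i, ξ i ≠ ∑ i : Fin m, (i.val : ℤ)) :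
    constantCoeff (hDet ξ) = 0 := by
  rw [hDet, RingHom.map_det, Matrix.det_apply]
  refine Finset.sum_eq_zero fun σ _ => ?_
  suffices ∃ i, ξ (σ i) ≠ i.val by
    obtain ⟨i, hi⟩ := this
    rw [Finset.prod_eq_zero (Finset.mem_univ i), smul_zero]
    simp [constantCoeff_hz, sub_eq_zero, hi]
  by_contra! heq
  exact h (by rw [← Equiv.sum_comp σ, Finset.sum_congr rfl fun i _ => heq i])

/-- Beads at distinct positions fill all positions below `k`, when there are enough of them. -/
theorem exists_eq_of_sum_add_le {m : ℕ} {ξ : Fin m → ℤ} (hinj : Function.Injective ξ)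
    (h0 : ∀ i, 0 ≤ ξ i) {k v : ℤ} (hsum : ∑ i, ξ i + k ≤ ∑ i : Fin m, (i.val : ℤ) + m)
    (hv0 : 0 ≤ v) (hvk : v < k) : ∃ i, ξ i = v := by
  by_contra! hv
  have hnot : v ∉ Finset.univ.image ξ := by simpa using hv
  have hle := Finset.sum_range_le_sum (s := insert v (Finset.univ.image ξ)) (c := 0) (by
    intro x hx
    rcases Finset.mem_insert.mp hx with rfl | hx
    · exact hv0
    · obtain ⟨i, -, rfl⟩ := Finset.mem_image.mp hx
      exact h0 i)
  rw [Finset.sum_insert hnot, Finset.card_insert_of_notMem hnot,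
    Finset.card_image_of_injective _ hinj, Finset.card_fin, Finset.sum_range_succ,
    Finset.sum_image fun a _ b _ hab => hinj hab] at hle
  rw [Finset.sum_range] at hle
  simp only [zero_add] at hle
  omega

theorem sum_val_le_sum {m : ℕ} {ξ : Fin m → ℤ} (hinj : Function.Injective ξ)
    (h0 : ∀ i, 0 ≤ ξ i) : ∑ i : Fin m, (i.val : ℤ) ≤ ∑ i, ξ i := by
  have hle := Finset.sum_range_le_sum (s := Finset.univ.image ξ) (c := 0) (by
    intro x hx
    obtain ⟨i, -, rfl⟩ := Finset.mem_image.mp hx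
    exact h0 i)
  rw [Finset.card_image_of_injective _ hinj, Finset.card_fin,
    Finset.sum_image fun a _ b _ hab => hinj hab, Finset.sum_range] at hle
  simpa using hle

theorem sum_hDet_add_single_of_not_injective {m : ℕ} {ξ : Fin m → ℤ} (k : ℤ)
    (h : ¬ Function.Injective ξ) : ∑ i, hDet (ξ + Pi.single i k) = 0 := by
  obtain ⟨a, b, hab, hne⟩ : ∃ a b, ξ a = ξ b ∧ a ≠ b := by
    simpa [Function.Injective] using h
  have hswap (i : Fin m) : hDet (ξ + Pi.single (Equiv.swap a b i) k) =
      -hDet (ξ + Pi.single i k) := by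
    have : ξ + Pi.single (Equiv.swap a b i) k = (ξ + Pi.single i k) ∘ Equiv.swap a b := by
      funext c
      have h1 : ξ (Equiv.swap a b c) = ξ c := by
        rw [Equiv.swap_apply_def]
        split_ifs with h1 h2
        · rw [h1, hab]
        · rw [h2, hab]
        · rfl
      simp only [Pi.add_apply, Function.comp_apply, h1, Pi.single_apply]
      congr 2
      rw [eq_iff_iff, Equiv.swap_apply_eq_iff]
    rw [this, hDet_comp_perm, Equiv.Perm.sign_swap hne]
    simp
  have h2 := Equiv.sum_comp (Equiv.swap a b) fun i => hDet (ξ + Pi.single i k)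
  simp only [hswap, Finset.sum_neg_distrib] at h2
  exact self_eq_neg.mp h2.symm

/-- Multiplication by the power sum `p_k` with `k = i + 1`, in terms of bead vectors. -/
theorem X_mul_hDet {m : ℕ} (k : ℕ) (ξ : Fin m → ℤ) (h0 : ∀ i, 0 ≤ ξ i)
    (hsum : ∑ i, ξ i + (k + 1) ≤ ∑ i : Fin m, (i.val : ℤ) + m) :
    X k * hDet ξ = ∑ i, hDet (ξ + Pi.single i ((k : ℤ) + 1)) := by
  induction hN : (∑ i, ξ i).toNat using Nat.strong_induction_on generalizing ξ with
  | _ N ih =>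
  subst hN
  have hsum0 : 0 ≤ ∑ i, ξ i := Finset.sum_nonneg fun i _ => h0 i
  by_cases hinj : Function.Injective ξ
  swap
  · rw [sum_hDet_add_single_of_not_injective _ hinj]
    obtain ⟨a, b, hab, hne⟩ : ∃ a b, ξ a = ξ b ∧ a ≠ b := by
      simpa [Function.Injective] using hinj
    rw [hDet_of_eq hne hab, mul_zero]
  refine eq_of_skewPower_eq (fun j => ?_) ?_
  swap
  · rw [map_mul, constantCoeff_X, zero_mul, map_sum]
    refine (Finset.sum_eq_zero fun i _ => constantCoeff_hDet ?_).symm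
    have := sum_val_le_sum hinj h0
    simp only [Pi.add_apply, Finset.sum_add_distrib, Finset.sum_pi_single', Finset.mem_univ,
      if_true]
    omega
  have hstep (l : Fin m) : X k * hDet (ξ - Pi.single l ((j : ℤ) + 1)) =
      ∑ i, hDet (ξ + Pi.single i ((k : ℤ) + 1) - Pi.single l ((j : ℤ) + 1)) -
        if ξ l < j + 1 then hDet (ξ + Pi.single l ((k : ℤ) - j)) else 0 := by
    split_ifs with hl
    · rw [hDet_of_neg (i := l) (by simpa using hl), mul_zero, Finset.sum_eq_single l, eq_comm,
        sub_eq_zero]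
      · rw [add_sub_assoc, ← Pi.single_sub]
        congr 3
        omega
      · intro i _ hi
        exact hDet_of_neg (i := l) (by simpa [Ne.symm hi] using hl)
      · simp
    · rw [ih _ ?_ _ ?_ ?_ rfl, sub_zero]
      · exact Finset.sum_congr rfl fun i _ => by rw [sub_add_eq_add_sub]
      · simp only [Pi.sub_apply, Finset.sum_sub_distrib, Finset.sum_pi_single', Finset.mem_univ,
          if_true]
        have : ξ l ≤ ∑ i, ξ i := Finset.single_le_sum (fun i _ => h0 i) (Finset.mem_univ l)
        omega
      · intro i
        by_cases hi : i = l
        · subst hi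
          simpa using hl
        · simpa [hi] using h0 i
      · simp only [Pi.sub_apply, Finset.sum_sub_distrib, Finset.sum_pi_single', Finset.mem_univ,
          if_true]
        omega
  have hboundary : ∑ l, (if ξ l < j + 1 then hDet (ξ + Pi.single l ((k : ℤ) - j)) else 0) =
      if j = k then C ((j : ℚ) + 1) * hDet ξ else 0 := by
    split_ifs with hjk
    · subst hjk
      simp only [sub_self, Pi.single_zero, add_zero]
      rw [← Finset.sum_filter, Finset.sum_const, nsmul_eq_mul]
      congr 1
      have : (Finset.univ.filter fun l => ξ l < j + 1).image ξ = Finset.Ico 0 ((j : ℤ) + 1) := by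
        ext v
        simp only [Finset.mem_image, Finset.mem_filter, Finset.mem_univ, true_and, Finset.mem_Ico]
        constructor
        · rintro ⟨l, hl, rfl⟩
          exact ⟨h0 l, hl⟩
        · rintro ⟨hv0, hv⟩
          obtain ⟨i, rfl⟩ := exists_eq_of_sum_add_le hinj h0 hsum hv0 hv
          exact ⟨i, hv, rfl⟩
      rw [← Finset.card_image_of_injective _ hinj, this, Int.card_Ico]
      simp only [sub_zero, ← Nat.cast_succ, Int.toNat_natCast]
      simp
    · refine Finset.sum_eq_zero fun l _ => ?_
      split_ifs with hl
      · rcases lt_or_ge (ξ l + (k - j)) 0 with hneg | hpos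
        · exact hDet_of_neg (i := l) (by simpa using hneg)
        · obtain ⟨i, hi⟩ := exists_eq_of_sum_add_le (v := ξ l + (k - j)) hinj h0 hsum hpos
            (by omega)
          have hil : i ≠ l := by
            rintro rfl
            omega
          exact hDet_of_eq hil (by simp [hil, hi])
      · rfl
  rw [Derivation.leibniz, skewPower_X, skewPower_hDet, smul_eq_mul, Finset.mul_sum,
    Finset.sum_congr rfl fun l _ => hstep l, Finset.sum_sub_distrib, hboundary, map_sum,
    Finset.sum_comm]
  simp_rw [skewPower_hDet]
  split_ifs <;> simp [mul_comm]

/-! ### The adjoint of the plethysm by `p_r` -/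

/-- The algebra endomorphism with `p_{rk} ↦ r p_k` and `p_k ↦ 0` for `r ∤ k`. -/
noncomputable def plethAdj (r : ℕ) : SymF →ₐ[ℚ] SymF :=
  aeval fun i => if r ∣ i + 1 then C (r : ℚ) * X ((i + 1) / r - 1) else 0

theorem constantCoeff_plethAdj (r : ℕ) (f : SymF) :
    constantCoeff (plethAdj r f) = constantCoeff f := by
  induction f using MvPolynomial.induction_on with
  | C a => rw [plethAdj, aeval_C, algebraMap_eq]
  | add p q hp hq => rw [map_add, map_add, hp, hq, map_add]
  | mul_X p i hp =>
    rw [map_mul, map_mul, map_mul, constantCoeff_X, plethAdj, aeval_X]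
    split_ifs <;> simp

theorem skewPower_plethAdj {r : ℕ} (hr : 0 < r) (j : ℕ) (f : SymF) :
    skewPower j (plethAdj r f) = plethAdj r (skewPower (r * (j + 1) - 1) f) := by
  have hpos : 0 < r * (j + 1) := by positivity
  have hX (i : ℕ) : skewPower j (plethAdj r (X i)) =
      plethAdj r (skewPower (r * (j + 1) - 1) (X i)) := by
    rw [skewPower_X, plethAdj, aeval_X]
    by_cases hi : r * (j + 1) - 1 = i
    · have hi' : i + 1 = r * (j + 1) := by omega
      rw [if_pos hi, hi', if_pos (dvd_mul_right r _), Nat.mul_div_cancel_left _ hr,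
        Derivation.leibniz, add_tsub_cancel_right, skewPower_X, if_pos rfl, aeval_C, algebraMap_eq,
        ← algebraMap_eq, Derivation.map_algebraMap, algebraMap_eq, smul_zero, add_zero,
        smul_eq_mul, ← C_mul]
      congr 1
      rw [Nat.cast_sub (by omega)]
      push_cast
      ring
    · rw [if_neg hi, map_zero]
      split_ifs with hd
      · obtain ⟨t, ht⟩ := hd
        have ht0 : 0 < t := Nat.pos_of_ne_zero (by rintro rfl; simp at ht)
        rw [ht, Nat.mul_div_cancel_left _ hr, Derivation.leibniz, skewPower_X, if_neg,
          ← algebraMap_eq, Derivation.map_algebraMap, smul_zero, smul_zero, add_zero]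
        rintro rfl
        rw [Nat.sub_add_cancel ht0] at hi
        omega
      · rw [map_zero]
  induction f using MvPolynomial.induction_on with
  | C a =>
    rw [plethAdj, aeval_C, ← algebraMap_eq, Derivation.map_algebraMap, Derivation.map_algebraMap,
      map_zero]
  | add p q hp hq => simp only [map_add, hp, hq]
  | mul_X p i hp => simp only [map_mul, Derivation.leibniz, hp, hX, map_add, smul_eq_mul]

theorem plethAdj_hz {r : ℕ} (hr : 0 < r) (z : ℤ) :
    plethAdj r (hz z) = if (r : ℤ) ∣ z then hz (z / r) else 0 := by
  have hr' : (0 : ℤ) < r := by exact_mod_cast hr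
  induction hN : z.toNat using Nat.strong_induction_on generalizing z with
  | _ N ih =>
  subst hN
  rcases lt_or_ge z 0 with hz0 | hz0
  · rw [hz_of_neg hz0, map_zero, hz_of_neg (Int.ediv_neg_of_neg_of_pos hz0 hr'), ite_self]
  refine eq_of_skewPower_eq (fun j => ?_) ?_
  · have hpos : 0 < r * (j + 1) := by positivity
    have hcast : ((r * (j + 1) - 1 : ℕ) : ℤ) + 1 = r * (j + 1) := by
      rw [Nat.cast_sub (by omega)]
      push_cast
      ring
    have hpos' : (0 : ℤ) < r * (j + 1) := by positivity
    rw [skewPower_plethAdj hr, skewPower_hz, hcast]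
    have hdvd : (r : ℤ) ∣ z - r * (j + 1) ↔ (r : ℤ) ∣ z := dvd_sub_left (dvd_mul_right _ _)
    have hval : plethAdj r (hz (z - r * (j + 1))) =
        if (r : ℤ) ∣ z then hz (z / r - (j + 1)) else 0 := by
      have hdiv : (z - r * (j + 1)) / r = z / r - (j + 1) := by
        rw [sub_eq_add_neg, ← mul_neg, Int.add_mul_ediv_left _ _ hr'.ne', sub_eq_add_neg]
      rcases Nat.eq_zero_or_pos z.toNat with h | h
      · have hz1 : z = 0 := by omega
        rw [hz_of_neg (by omega), map_zero, hz_of_neg (by rw [hz1]; simp; omega), ite_self]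
      · rw [ih _ (by omega) _ rfl, hdiv]
        simp only [hdvd]
    rw [hval]
    split_ifs
    · rw [skewPower_hz]
    · rw [map_zero]
  · rw [constantCoeff_plethAdj, constantCoeff_hz]
    by_cases h : z = 0
    · subst h
      simp [constantCoeff_hz]
    · rw [if_neg h]
      split_ifs with hd
      · rw [constantCoeff_hz, if_neg]
        exact fun h0 => h (Int.eq_zero_of_ediv_eq_zero hd h0)
      · rw [map_zero]

theorem plethAdj_hDet {r m : ℕ} (hr : 0 < r) (ξ : Fin m → ℤ) :
    plethAdj r (hDet ξ) = Matrix.det (Matrix.of fun i j : Fin m =>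
      if (r : ℤ) ∣ ξ i - j.val then hz ((ξ i - j.val) / r) else 0) := by
  rw [hDet, AlgHom.map_det]
  exact congrArg Matrix.det (Matrix.ext fun i j => plethAdj_hz hr _)

theorem plethAdj_hDet_of_card_ne {r m : ℕ} (hr : 0 < r) (ξ : Fin m → ℕ) (k : ℕ)
    (h : (Finset.univ.filter fun i => ξ i % r = k).card ≠
      (Finset.univ.filter fun i : Fin m => i.val % r = k).card) :
    plethAdj r (hDet fun i => (ξ i : ℤ)) = 0 := by
  rw [plethAdj_hDet hr, Matrix.det_apply]
  refine Finset.sum_eq_zero fun σ _ => ?_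
  suffices ∃ i, ξ (σ i) % r ≠ i.val % r by
    obtain ⟨i, hi⟩ := this
    rw [Finset.prod_eq_zero (Finset.mem_univ i), smul_zero]
    rw [Matrix.of_apply, if_neg]
    rw [← Nat.modEq_iff_dvd]
    exact fun h => hi h.symm
  by_contra! heq
  refine h ?_
  refine (Finset.card_bij (fun i _ => σ i) ?_ (fun i _ j _ hij => σ.injective hij) ?_).symm
  · intro i hi
    simpa [heq i] using hi
  · intro i hi
    exact ⟨σ.symm i, by simpa [← heq] using hi, by simp⟩

theorem plethAdj_hDet_of_equiv {r m L : ℕ} (hr : 0 < r) (ξ : Fin m → ℕ) (M : Fin r → Fin L → ℕ)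
    (e g : Fin L × Fin r ≃ Fin m) (he : ∀ x, (e x).val = r * x.1.val + x.2.val)
    (hg : ∀ x, ξ (g x) = r * M x.2 x.1 + x.2.val) :
    plethAdj r (hDet fun i => (ξ i : ℤ)) =
      ((Equiv.Perm.sign (g.symm.trans e) : ℤ) : SymF) * ∏ k, hDet fun j => (M k j : ℤ) := by
  have hr' : (0 : ℤ) < r := by exact_mod_cast hr
  set A : Matrix (Fin m) (Fin m) SymF := Matrix.of fun i j =>
      if (r : ℤ) ∣ (ξ i : ℤ) - j.val then hz (((ξ i : ℤ) - j.val) / r) else 0 with hA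
  have hblock : A.submatrix g e = Matrix.blockDiagonal fun k : Fin r =>
      Matrix.of fun i j : Fin L => hz ((M k i : ℤ) - j.val) := by
    ext x y : 1
    rw [Matrix.submatrix_apply, Matrix.blockDiagonal_apply, hA, Matrix.of_apply, Matrix.of_apply,
      hg, he]
    have hx := x.2.isLt
    have hy := y.2.isLt
    have hdvd : ((r : ℤ) ∣ ((r * M x.2 x.1 + x.2.val : ℕ) : ℤ) - ((r * y.1.val + y.2.val : ℕ) : ℤ))
        ↔ x.2 = y.2 := by
      rw [← Nat.modEq_iff_dvd, Nat.ModEq, Nat.mul_add_mod, Nat.mul_add_mod, Nat.mod_eq_of_lt hx,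
        Nat.mod_eq_of_lt hy, eq_comm, Fin.ext_iff]
    simp only [hdvd]
    split_ifs with h
    · rw [h]
      congr 1
      push_cast
      rw [add_sub_add_right_eq_sub, ← mul_sub, Int.mul_ediv_cancel_left _ hr'.ne']
    · rfl
  have hperm : A.submatrix g e = (A.submatrix (e.symm.trans g) id).submatrix e e := by
    ext x y : 1
    simp
  have hdet := congrArg Matrix.det hblock
  rw [hperm, Matrix.det_submatrix_equiv_self, Matrix.det_permute, Matrix.det_blockDiagonal] at hdet
  have hinv : g.symm.trans e = (e.symm.trans g)⁻¹ := rfl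
  rw [plethAdj_hDet hr, hinv, Equiv.Perm.sign_inv]
  simp only [hDet, ← hdet, ← mul_assoc, ← Int.cast_mul, ← Units.val_mul, Int.units_mul_self]
  simp [hA]

/-! ### Partitions and their beads -/

theorem getD_filter_pos_of_pairwise {l : List ℕ} (h : l.Pairwise (· ≥ ·)) (i : ℕ) :
    (l.filter fun x => 0 < x).getD i 0 = l.getD i 0 := by
  induction l generalizing i with
  | nil => simp
  | cons a l ih =>
    rw [List.pairwise_cons] at h
    rcases Nat.eq_zero_or_pos a with rfl | ha
    · have hl : ∀ x ∈ l, x = 0 := fun x hx => Nat.le_zero.mp (h.1 x hx)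
      have : (0 :: l).filter (fun x => 0 < x) = [] := by
        simpa using hl
      rw [this]
      rcases i with _ | i
      · simp
      · rw [List.getD_cons_succ, ← ih h.2, List.filter_eq_nil_iff.mpr fun x hx => by simp [hl x hx]]
        simp
    · rw [List.filter_cons_of_pos (by simpa using ha)]
      rcases i with _ | i
      · simp
      · simpa using ih h.2 i

namespace Ptn

theorem ext_parts {l l' : Ptn} (h : l.parts = l'.parts) : l = l' := by
  cases l
  cases l'
  congr

theorem parts_of (s : Multiset ℕ) : (of s).parts = s.filter fun x => 0 < x := rfl

theorem part_of_coe {l : List ℕ} (h : l.Pairwise (· ≥ ·)) (i : ℕ) :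
    (of (l : Multiset ℕ)).part i = l.getD i 0 := by
  rw [part, ← getD_filter_pos_of_pairwise h i]
  congr 1
  have hs : ((of (l : Multiset ℕ)).parts.sort (· ≤ ·)).reverse.Pairwise (· ≥ ·) :=
    List.pairwise_reverse.mpr (Multiset.pairwise_sort _ _)
  refine List.Perm.eq_of_pairwise' hs (h.filter _) ?_
  rw [← Multiset.coe_eq_coe, Multiset.coe_reverse, Multiset.sort_eq]
  rfl

theorem part_antitone (l : Ptn) : Antitone l.part := by
  intro i j hij
  have hs : (l.parts.sort (· ≤ ·)).reverse.Pairwise (· ≥ ·) :=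
    List.pairwise_reverse.mpr (Multiset.pairwise_sort _ _)
  rw [part, part]
  rcases lt_or_ge j (l.parts.sort (· ≤ ·)).reverse.length with hj | hj
  · rw [List.getD_eq_getElem _ _ hj, List.getD_eq_getElem _ _ (hij.trans_lt hj)]
    rcases hij.eq_or_lt with rfl | hij
    · exact le_rfl
    · exact List.pairwise_iff_getElem.mp hs i j _ _ hij
  · rw [List.getD_eq_default _ _ hj]
    exact Nat.zero_le _

theorem part_eq_zero {l : Ptn} {i : ℕ} (h : l.length ≤ i) : l.part i = 0 :=
  List.getD_eq_default _ _ (by simpa [length] using h)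

theorem of_map_part {l : Ptn} {M : ℕ} (h : l.length ≤ M) :
    of ((Multiset.range M).map l.part) = l := by
  refine ext_parts ?_
  obtain ⟨c, rfl⟩ := Nat.exists_eq_add_of_le h
  have hlen : (l.parts.sort (· ≤ ·)).reverse.length = l.length := by simp [length]
  have hlist : (List.range (l.length + c)).map l.part =
      (l.parts.sort (· ≤ ·)).reverse ++ List.replicate c 0 := by
    refine List.ext_getElem (by simp [length]) fun i h1 h2 => ?_
    rw [List.getElem_map, List.getElem_range, part]
    rcases lt_or_ge i l.length with hi | hi
    · rw [List.getElem_append_left (hlen ▸ hi), List.getD_eq_getElem _ _ (hlen ▸ hi)]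
    · rw [List.getElem_append_right (hlen ▸ hi), List.getD_eq_default _ _ (hlen ▸ hi)]
      simp
  have hcoe : (Multiset.range (l.length + c)).map l.part =
      (((List.range (l.length + c)).map l.part : List ℕ) : Multiset ℕ) := rfl
  rw [parts_of, hcoe, hlist, ← Multiset.coe_add, Multiset.coe_reverse, Multiset.sort_eq,
    Multiset.filter_add, Multiset.filter_eq_self.mpr l.pos, Multiset.coe_replicate]
  simpa using fun a ha => Multiset.eq_of_mem_replicate ha

theorem size_of (s : Multiset ℕ) : (of s).size = s.sum := by
  rw [size, of]
  conv_rhs => rw [← Multiset.filter_add_not (fun x => 0 < x) s, Multiset.sum_add]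
  rw [left_eq_add]
  refine Multiset.sum_eq_zero fun x hx => ?_
  have := (Multiset.mem_filter.mp hx).2
  omega

theorem size_eq_sum {l : Ptn} {M : ℕ} (h : l.length ≤ M) :
    l.size = ∑ i ∈ Finset.range M, l.part i := by
  conv_lhs => rw [← of_map_part h, size_of]
  rfl

theorem length_le_size (l : Ptn) : l.length ≤ l.size := by
  have := Multiset.card_nsmul_le_sum (s := l.parts) (a := 1) fun x hx => l.pos x hx
  simpa [length, size] using this

/-- The positions of `m` beads representing a partition, in increasing order. -/
def beads (l : Ptn) (m : ℕ) (i : Fin m) : ℕ := l.part (m - 1 - i.val) + i.val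

theorem beads_strictMono (l : Ptn) (m : ℕ) : StrictMono (l.beads m) := by
  intro i j hij
  have := l.part_antitone (show m - 1 - j.val ≤ m - 1 - i.val by omega)
  have hij : i.val < j.val := hij
  simp only [beads]
  omega

theorem image_beads (l : Ptn) (m : ℕ) : Finset.univ.image (l.beads m) = betaSet l m := by
  ext p
  simp only [betaSet, Finset.mem_image, Finset.mem_univ, true_and, Finset.mem_range, beads]
  constructor
  · rintro ⟨i, rfl⟩
    exact ⟨m - 1 - i.val, by omega, by omega⟩
  · rintro ⟨i, hi, rfl⟩
    refine ⟨⟨m - 1 - i, by omega⟩, ?_⟩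
    rw [show m - 1 - (m - 1 - i) = i by omega]

theorem eq_of_beads_eq {l l' : Ptn} {m : ℕ} (h : l.length ≤ m) (h' : l'.length ≤ m)
    (hb : l.beads m = l'.beads m) : l = l' := by
  rw [← of_map_part h, ← of_map_part h']
  congr 1
  refine Multiset.map_congr rfl fun i hi => ?_
  have hi := Multiset.mem_range.mp hi
  have := congrFun hb ⟨m - 1 - i, by omega⟩
  simp only [beads, show m - 1 - (m - 1 - i) = i by omega] at this
  omega

theorem sum_beads {l : Ptn} {m : ℕ} (h : l.length ≤ m) :
    ∑ i, l.beads m i = l.size + ∑ i : Fin m, i.val := by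
  simp only [beads, Finset.sum_add_distrib]
  rw [size_eq_sum h, ← Finset.sum_range_reflect, Finset.sum_range]

end Ptn

theorem schur_eq_hDet {l : Ptn} {m : ℕ} (h : l.length ≤ m) :
    schur l = hDet fun i => (l.beads m i : ℤ) := by
  induction m, h using Nat.le_induction with
  | base =>
    rw [schur, hDet, ← Matrix.det_submatrix_equiv_self Fin.revPerm]
    congr 1
    ext i j : 1
    simp only [Matrix.submatrix_apply, Matrix.of_apply, Fin.revPerm_apply, Fin.val_rev, Ptn.beads]
    rw [show l.length - (i.val + 1) = l.length - 1 - i.val by omega]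
    congr 1
    omega
  | succ m hm ih =>
    rw [ih, hDet, hDet, Matrix.det_succ_row_zero, Fin.sum_univ_succ, Finset.sum_eq_zero, add_zero]
    · have h0 : l.beads (m + 1) 0 = 0 := by simp [Ptn.beads, Ptn.part_eq_zero hm]
      simp only [Matrix.of_apply, h0, Fin.val_zero, pow_zero, Nat.cast_zero, sub_zero, hz_zero,
        one_mul]
      congr 1
      ext i j : 1
      simp only [Matrix.submatrix_apply, Matrix.of_apply, Ptn.beads, Fin.zero_succAbove,
        Fin.val_succ]
      rw [show m + 1 - 1 - (i.val + 1) = m - 1 - i.val by omega]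
      congr 1
      push_cast
      ring
    · intro j _
      have h0 : l.beads (m + 1) 0 = 0 := by simp [Ptn.beads, Ptn.part_eq_zero hm]
      rw [Matrix.of_apply, h0, hz_of_neg (by simp; omega)]
      simp

theorem strictMono_add_le {m : ℕ} {ξ : Fin m → ℕ} (hξ : StrictMono ξ) {i j : Fin m}
    (hij : i ≤ j) : ξ i + j.val ≤ ξ j + i.val := by
  obtain ⟨j, hj⟩ := j
  induction j with
  | zero =>
    obtain rfl : i = ⟨0, hj⟩ := le_antisymm hij (Fin.mk_le_of_le_val (Nat.zero_le _))
    exact le_rfl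
  | succ j ih =>
    rcases hij.eq_or_lt with rfl | hlt
    · exact le_rfl
    · have hle := ih (by omega) (by
        have : i.val < j + 1 := hlt
        exact Fin.le_def.mpr (by simp; omega))
      have := hξ (show (⟨j, by omega⟩ : Fin m) < ⟨j + 1, hj⟩ from Fin.mk_lt_mk.mpr (by omega))
      simp only at hle ⊢
      omega

theorem card_filter_lt_strictMono {m : ℕ} {ξ : Fin m → ℕ} (hξ : StrictMono ξ) (i : Fin m) :
    ((Finset.univ.image ξ).filter fun q => q < ξ i).card = i.val := by
  have : (Finset.univ.image ξ).filter (fun q => q < ξ i) = (Finset.Iio i).image ξ := by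
    ext q
    simp only [Finset.mem_filter, Finset.mem_image, Finset.mem_univ, true_and, Finset.mem_Iio]
    constructor
    · rintro ⟨⟨j, rfl⟩, hj⟩
      exact ⟨j, hξ.lt_iff_lt.mp hj, rfl⟩
    · rintro ⟨j, hj, rfl⟩
      exact ⟨⟨j, rfl⟩, hξ hj⟩
  rw [this, Finset.card_image_of_injective _ hξ.injective, Fin.card_Iio]

theorem val_le_strictMono {m : ℕ} {ξ : Fin m → ℕ} (hξ : StrictMono ξ) (i : Fin m) :
    i.val ≤ ξ i := by
  have := strictMono_add_le hξ (show (⟨0, i.pos⟩ : Fin m) ≤ i from Fin.mk_le_of_le_val (by simp))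
  simp only at this
  omega

theorem ptnOfBeads_image {m : ℕ} {ξ : Fin m → ℕ} (hξ : StrictMono ξ) :
    ptnOfBeads (Finset.univ.image ξ) =
      Ptn.of ((List.ofFn fun i : Fin m => ξ i.rev - i.rev.val : List ℕ) : Multiset ℕ) := by
  rw [ptnOfBeads]
  congr 1
  rw [Finset.image_val_of_injOn hξ.injective.injOn, Multiset.map_map,
    Multiset.map_congr rfl fun i _ => by rw [Function.comp_apply, card_filter_lt_strictMono hξ i],
    List.ofFn_eq_map, ← Multiset.map_coe]
  conv_lhs => rw [← Finset.map_univ_equiv Fin.revPerm, Finset.map_val, Multiset.map_map]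
  rfl

theorem length_ptnOfBeads_image_le {m : ℕ} (ξ : Fin m → ℕ) :
    (ptnOfBeads (Finset.univ.image ξ)).length ≤ m := by
  rw [Ptn.length, ptnOfBeads, Ptn.parts_of]
  refine (Multiset.card_le_card (Multiset.filter_le _ _)).trans ?_
  rw [Multiset.card_map]
  exact Finset.card_image_le.trans_eq (Finset.card_fin m)

theorem beads_ptnOfBeads_image {m : ℕ} {ξ : Fin m → ℕ} (hξ : StrictMono ξ) :
    (ptnOfBeads (Finset.univ.image ξ)).beads m = ξ := by
  funext i
  rw [Ptn.beads, ptnOfBeads_image hξ, Ptn.part_of_coe]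
  · rw [List.getD_eq_getElem _ _ (by simp; omega), List.getElem_ofFn]
    have hi : Fin.rev ⟨m - 1 - i.val, by omega⟩ = i := by
      ext
      simp only [Fin.val_rev]
      omega
    rw [hi]
    exact Nat.sub_add_cancel (val_le_strictMono hξ i)
  · rw [List.pairwise_ofFn]
    intro a b hab
    have := strictMono_add_le hξ (Fin.rev_le_rev.mpr hab.le)
    omega

theorem schur_ptnOfBeads {B : Finset ℕ} {m : ℕ} (h : B.card = m) :
    schur (ptnOfBeads B) = hDet fun i => (B.orderEmbOfFin h i : ℤ) := by
  have himage := B.image_orderEmbOfFin_univ h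
  have hmono := (B.orderEmbOfFin h).strictMono
  conv_lhs => rw [← himage]
  rw [schur_eq_hDet (length_ptnOfBeads_image_le _), beads_ptnOfBeads_image hmono]

/-! ### The abacus and the Littlewood factorisation -/

theorem mem_runnerLevels {r : ℕ} (hr : 0 < r) (l : Ptn) (k s : ℕ) :
    s ∈ runnerLevels r l k ↔ r * s + k ∈ betaSet l (r * l.length) := by
  rw [runnerLevels, Finset.mem_filter, and_iff_right_iff_imp]
  intro h
  obtain ⟨i, hi, hs⟩ := Finset.mem_image.mp h
  have h1 := l.part_antitone (Nat.zero_le i)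
  have h2 : s ≤ r * s := Nat.le_mul_of_pos_left s hr
  have h3 := Finset.mem_range.mp hi
  exact Finset.mem_range.mpr (by omega)

theorem card_runnerLevels {r : ℕ} (l : Ptn) {k : ℕ} (hk : k < r) :
    (runnerLevels r l k).card =
      (Finset.univ.filter fun i => l.beads (r * l.length) i % r = k).card := by
  have hr : 0 < r := by omega
  symm
  refine Finset.card_bij (fun i _ => l.beads (r * l.length) i / r) ?_ ?_ ?_
  · intro i hi
    have hi : l.beads (r * l.length) i % r = k := (Finset.mem_filter.mp hi).2
    rw [mem_runnerLevels hr, ← hi, Nat.div_add_mod, ← Ptn.image_beads]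
    exact Finset.mem_image_of_mem _ (Finset.mem_univ i)
  · intro i hi j hj hij
    have hi : l.beads (r * l.length) i % r = k := (Finset.mem_filter.mp hi).2
    have hj : l.beads (r * l.length) j % r = k := (Finset.mem_filter.mp hj).2
    refine (l.beads_strictMono _).injective ?_
    rw [← Nat.div_add_mod (l.beads _ i) r, ← Nat.div_add_mod (l.beads _ j) r, hij, hi, hj]
  · intro s hs
    rw [mem_runnerLevels hr, ← Ptn.image_beads] at hs
    obtain ⟨i, -, hi⟩ := Finset.mem_image.mp hs
    refine ⟨i, ?_, ?_⟩
    · simp [hi, Nat.mod_eq_of_lt hk]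
    · rw [hi, Nat.mul_add_div hr, Nat.div_eq_of_lt hk, add_zero]

/-- Positions of an `r`-abacus with `L` rows, listed by row and runner. -/
def abacusEquiv (r L : ℕ) : Fin L × Fin r ≃ Fin (r * L) :=
  finProdFinEquiv.trans (finCongr (mul_comm L r))

theorem abacusEquiv_val (r L : ℕ) (x : Fin L × Fin r) :
    (abacusEquiv r L x).val = r * x.1.val + x.2.val := by
  simp [abacusEquiv, add_comm]

theorem card_filter_val_mod {r L k : ℕ} (hk : k < r) :
    (Finset.univ.filter fun i : Fin (r * L) => i.val % r = k).card = L := by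
  conv_rhs => rw [← Finset.card_fin L]
  symm
  refine Finset.card_bij (fun j _ => abacusEquiv r L (j, ⟨k, hk⟩)) ?_ ?_ ?_
  · intro j _
    simp [abacusEquiv_val, Nat.mod_eq_of_lt hk]
  · intro i _ j _ hij
    exact (Prod.ext_iff.mp ((abacusEquiv r L).injective hij)).1
  · intro i hi
    have hi : i.val % r = k := (Finset.mem_filter.mp hi).2
    obtain ⟨⟨j, k'⟩, rfl⟩ := (abacusEquiv r L).surjective i
    refine ⟨j, Finset.mem_univ j, ?_⟩
    rw [abacusEquiv_val, Nat.mul_add_mod, Nat.mod_eq_of_lt k'.isLt] at hi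
    subst hi
    rfl

theorem sum_card_runnerLevels {r : ℕ} (hr : 0 < r) (l : Ptn) :
    ∑ k ∈ Finset.range r, (runnerLevels r l k).card = r * l.length := by
  rw [Finset.sum_congr rfl fun k hk => card_runnerLevels l (Finset.mem_range.mp hk),
    ← Finset.card_eq_sum_card_fiberwise, Finset.card_fin]
  exact fun i _ => Finset.mem_coe.mpr (Finset.mem_range.mpr (Nat.mod_lt _ hr))

theorem coreP_eq_empty_iff {r : ℕ} (hr : 0 < r) (l : Ptn) :
    coreP r l = Ptn.empty ↔ ∀ k < r, (runnerLevels r l k).card = l.length := by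
  rw [coreP]
  set c := fun k => (runnerLevels r l k).card with hc
  change ptnOfBeads ((Finset.range r).biUnion fun k => (Finset.range (c k)).image fun s =>
    r * s + k) = _ ↔ ∀ k < r, c k = l.length
  set B := (Finset.range r).biUnion fun k => (Finset.range (c k)).image fun s => r * s + k with hB
  have hmem {k s : ℕ} (hk : k < r) : r * s + k ∈ B ↔ s < c k := by
    rw [hB]
    simp only [Finset.mem_biUnion, Finset.mem_image, Finset.mem_range]
    constructor
    · rintro ⟨k', hk', s', hs', h⟩
      have h1 := congrArg (· % r) h
      have h2 := congrArg (· / r) h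
      simp only [Nat.mul_add_mod, Nat.mod_eq_of_lt hk, Nat.mod_eq_of_lt hk', Nat.mul_add_div hr,
        Nat.div_eq_of_lt hk, Nat.div_eq_of_lt hk', add_zero] at h1 h2
      rwa [← h1, ← h2]
    · exact fun hs => ⟨k, hk, s, hs, rfl⟩
  have hcard : B.card = r * l.length := by
    rw [hB, Finset.card_biUnion, ← sum_card_runnerLevels hr l]
    · refine Finset.sum_congr rfl fun k _ => ?_
      rw [Finset.card_image_of_injective, Finset.card_range]
      intro s t hst
      exact Nat.eq_of_mul_eq_mul_left hr (Nat.add_right_cancel hst)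
    · intro k hk k' hk' hne
      rw [Function.onFun, Finset.disjoint_left]
      intro p hp hp'
      obtain ⟨s, -, rfl⟩ := Finset.mem_image.mp hp
      obtain ⟨s', -, h⟩ := Finset.mem_image.mp hp'
      have h1 := congrArg (· % r) h
      simp only [Nat.mul_add_mod, Nat.mod_eq_of_lt (Finset.mem_range.mp hk),
        Nat.mod_eq_of_lt (Finset.mem_range.mp hk')] at h1
      exact hne h1.symm
  constructor
  · intro hempty k hk
    have hsub : B ⊆ Finset.range (r * l.length) := by
      intro p hp
      have hle : p ≤ (B.filter fun q => q < p).card := by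
        by_contra! hlt
        have hmem : p - (B.filter fun q => q < p).card ∈ (ptnOfBeads B).parts := by
          rw [ptnOfBeads, Ptn.parts_of, Multiset.mem_filter]
          exact ⟨Multiset.mem_map.mpr ⟨p, hp, rfl⟩, by omega⟩
        rw [hempty] at hmem
        simp [Ptn.empty] at hmem
      have hlt : (B.filter fun q => q < p).card < B.card :=
        Finset.card_lt_card (Finset.filter_ssubset.mpr ⟨p, hp, lt_irrefl p⟩)
      exact Finset.mem_range.mpr (by omega)
    have hrange := Finset.eq_of_subset_of_card_le hsub (by simp [hcard])
    rw [hrange] at hmem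
    have h1 := hmem (s := c k) hk
    have h2 := hmem (s := l.length) hk
    simp only [Finset.mem_range, lt_self_iff_false, iff_false, not_lt] at h1 h2
    have h3 : ¬ l.length < c k := by
      rw [← h2]
      omega
    by_contra hne
    have h4 : c k + 1 ≤ l.length := by omega
    have h5 := Nat.mul_le_mul_left r h4
    rw [mul_add, mul_one] at h5
    omega
  · intro h
    have hrange : B = Finset.range (r * l.length) := by
      refine Finset.eq_of_subset_of_card_le (fun p hp => ?_) (by simp [hcard])
      have hlt := Nat.mod_lt p hr
      rw [← Nat.div_add_mod p r, hmem hlt, h _ hlt] at hp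
      rw [Finset.mem_range]
      exact mul_comm l.length r ▸ (Nat.div_lt_iff_lt_mul hr).mp hp
    refine Ptn.ext_parts ?_
    rw [ptnOfBeads, Ptn.parts_of, Multiset.filter_eq_nil.mpr]
    · rfl
    · intro x hx
      obtain ⟨p, hp, rfl⟩ := Multiset.mem_map.mp hx
      have hp : p < r * l.length := by simpa [hrange] using hp
      have : (B.filter fun q => q < p) = Finset.range p := by
        ext q
        simp only [hrange, Finset.mem_filter, Finset.mem_range]
        omega
      simp [this]

theorem sign_eq_neg_one_pow_inversions {m : ℕ} {ξ : Fin m → ℕ} (hξ : StrictMono ξ)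
    (π : Equiv.Perm (Fin m)) {key : ℕ → ℕ} (hkey : ∀ i, key (ξ i) = (π i).val) :
    (Equiv.Perm.sign π : ℤ) = (-1) ^ inversions key (Finset.univ.image ξ) := by
  have hinv : inversions key (Finset.univ.image ξ) =
      (Finset.univ.filter fun x : Fin m × Fin m => x.1 < x.2 ∧ π x.2 < π x.1).card := by
    symm
    refine Finset.card_bij (fun x _ => (ξ x.1, ξ x.2)) ?_ ?_ ?_
    · intro x hx
      simpa [hkey, hξ.lt_iff_lt] using hx
    · intro x _ y _ hxy
      exact Prod.ext (hξ.injective (Prod.ext_iff.mp hxy).1) (hξ.injective (Prod.ext_iff.mp hxy).2)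
    · rintro ⟨p, q⟩ hpq
      simp only [Finset.mem_filter, Finset.mem_product, Finset.mem_image, Finset.mem_univ,
        true_and] at hpq
      obtain ⟨⟨⟨i, rfl⟩, ⟨j, rfl⟩⟩, h1, h2⟩ := hpq
      refine ⟨(i, j), ?_, rfl⟩
      simpa [hkey, hξ.lt_iff_lt] using And.intro h1 h2
  rw [hinv, Equiv.Perm.sign_eq_prod_prod_Ioi, ← Finset.prod_const, Finset.prod_filter,
    ← Finset.univ_product_univ, Finset.prod_product, Units.coe_prod]
  refine Finset.prod_congr rfl fun i _ => ?_
  rw [Units.coe_prod, ← Finset.filter_lt_eq_Ioi, Finset.prod_filter]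
  refine Finset.prod_congr rfl fun j _ => ?_
  by_cases hij : i < j
  · have hne : π i ≠ π j := fun h => hij.ne (π.injective h)
    rcases hne.lt_or_gt with h | h
    · simp [h, h.not_gt]
    · simp [h, h.not_gt, hij]
  · simp [hij]

theorem plethAdj_schur_of_core_ne {r : ℕ} (hr : 0 < r) {l : Ptn} (h : coreP r l ≠ Ptn.empty) :
    plethAdj r (schur l) = 0 := by
  rw [ne_eq, coreP_eq_empty_iff hr] at h
  push Not at h
  obtain ⟨k, hk, hne⟩ := h
  rw [schur_eq_hDet (Nat.le_mul_of_pos_left l.length hr)]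
  refine plethAdj_hDet_of_card_ne hr _ k ?_
  rwa [← card_runnerLevels l hk, card_filter_val_mod hk]

/-- The Littlewood factorisation of the image of a Schur function with empty `r`-core. -/
theorem plethAdj_schur {r : ℕ} (hr : 0 < r) {l : Ptn} (h : coreP r l = Ptn.empty) :
    plethAdj r (schur l) =
      ((rSign r l : ℤ) : SymF) * ∏ k ∈ Finset.range r, schur (quotP r l k) := by
  rw [coreP_eq_empty_iff hr] at h
  set m := r * l.length with hm
  set B := betaSet l m with hB
  let M (k : Fin r) : Fin l.length ↪o ℕ := (runnerLevels r l k).orderEmbOfFin (h k k.isLt)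
  have hM (k : Fin r) (j : Fin l.length) : r * M k j + k.val ∈ B :=
    (mem_runnerLevels hr l k _).mp (Finset.orderEmbOfFin_mem _ _ j)
  have hex (x : Fin l.length × Fin r) : ∃ i, l.beads m i = r * M x.2 x.1 + x.2.val := by
    have := hM x.2 x.1
    rw [hB, ← Ptn.image_beads] at this
    obtain ⟨i, -, hi⟩ := Finset.mem_image.mp this
    exact ⟨i, hi⟩
  choose g hg using hex
  have hginj : Function.Injective g := by
    rintro ⟨j, k⟩ ⟨j', k'⟩ hx
    have heq : r * M k j + k.val = r * M k' j' + k'.val := by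
      rw [← hg (j, k), ← hg (j', k'), hx]
    have h1 := congrArg (· % r) heq
    have h2 := congrArg (· / r) heq
    simp only [Nat.mul_add_mod, Nat.mod_eq_of_lt k.isLt, Nat.mod_eq_of_lt k'.isLt,
      Nat.mul_add_div hr, Nat.div_eq_of_lt k.isLt, Nat.div_eq_of_lt k'.isLt, add_zero] at h1 h2
    obtain rfl := Fin.ext h1
    rw [(M k).injective h2]
  have hgbij : Function.Bijective g :=
    (Fintype.bijective_iff_injective_and_card g).mpr ⟨hginj, by simp [hm, mul_comm]⟩
  have hkey (i : Fin m) : rKey r B (l.beads m i) =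
      (((Equiv.ofBijective g hgbij).symm.trans (abacusEquiv r l.length)) i).val := by
    obtain ⟨⟨j, k⟩, rfl⟩ := hgbij.2 i
    rw [Equiv.trans_apply, Equiv.ofBijective_symm_apply_apply, abacusEquiv_val, hg, rKey,
      Nat.mul_add_mod, Nat.mod_eq_of_lt k.isLt]
    congr 2
    have : B.filter (fun q => q % r = k.val ∧ q < r * M k j + k.val) =
        (Finset.Iio j).image fun i => r * M k i + k.val := by
      ext q
      simp only [Finset.mem_filter, Finset.mem_image, Finset.mem_Iio]
      constructor
      · rintro ⟨hq, hqk, hlt⟩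
        have hdiv : r * (q / r) + k.val = q := by rw [← hqk, Nat.div_add_mod]
        rw [← hdiv, hB, hm, ← mem_runnerLevels hr, ← Finset.mem_coe,
          ← Finset.range_orderEmbOfFin _ (h k k.isLt)] at hq
        obtain ⟨i, hi⟩ := hq
        refine ⟨i, (M k).lt_iff_lt.mp ?_, ?_⟩
        · change M k i = q / r at hi
          rw [hi]
          rw [← hdiv] at hlt
          exact lt_of_mul_lt_mul_left (Nat.lt_of_add_lt_add_right hlt) (Nat.zero_le r)
        · change M k i = q / r at hi
          rw [hi, hdiv]
      · rintro ⟨i, hi, rfl⟩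
        refine ⟨hM k i, by rw [Nat.mul_add_mod, Nat.mod_eq_of_lt k.isLt], ?_⟩
        exact Nat.add_lt_add_right (Nat.mul_lt_mul_of_pos_left ((M k).lt_iff_lt.mpr hi) hr) _
    rw [this, Finset.card_image_of_injective, Fin.card_Iio]
    intro a b hab
    exact (M k).injective (Nat.eq_of_mul_eq_mul_left hr (Nat.add_right_cancel hab))
  rw [schur_eq_hDet (Nat.le_mul_of_pos_left l.length hr),
    plethAdj_hDet_of_equiv hr _ (fun k j => M k j) (abacusEquiv r l.length)
      (Equiv.ofBijective g hgbij) (abacusEquiv_val r l.length) hg,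
    sign_eq_neg_one_pow_inversions (l.beads_strictMono m) _ hkey, Ptn.image_beads, ← hB,
    Finset.prod_range]
  congr 1
  exact Finset.prod_congr rfl fun k _ => (schur_ptnOfBeads (h k k.isLt)).symm

/-! ### Sums over partitions as sums over bead configurations -/

theorem Ptn.bijOn_beads (m N : ℕ) :
    Set.BijOn (fun l : Ptn => l.beads m) {l | l.size = N ∧ l.length ≤ m}
      ((Finset.univ.piAntidiag (N + ∑ i : Fin m, i.val)).filter fun ξ => StrictMono ξ :
        Finset (Fin m → ℕ)) := by
  refine ⟨fun l hl => ?_, fun l hl l' hl' h => Ptn.eq_of_beads_eq hl.2 hl'.2 h, fun ξ hξ => ?_⟩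
  · simp [Ptn.sum_beads hl.2, hl.1, l.beads_strictMono m]
  · simp only [Finset.coe_filter, Finset.mem_piAntidiag, Finset.mem_univ, implies_true, and_true,
      Set.mem_ofPred_eq] at hξ
    have hlen := length_ptnOfBeads_image_le ξ
    refine ⟨ptnOfBeads (Finset.univ.image ξ), ⟨?_, hlen⟩, beads_ptnOfBeads_image hξ.2⟩
    have := Ptn.sum_beads hlen
    rw [beads_ptnOfBeads_image hξ.2, hξ.1] at this
    exact (Nat.add_right_cancel this).symm

theorem sum_piAntidiag_eq_factorial_mul_finsum {m : ℕ} (N : ℕ) {G : (Fin m → ℕ) → ℚ}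
    (hperm : ∀ ξ (σ : Equiv.Perm (Fin m)), G (ξ ∘ σ) = G ξ)
    (hinj : ∀ ξ, ¬ Function.Injective ξ → G ξ = 0) :
    ∑ ξ ∈ Finset.univ.piAntidiag (N + ∑ i : Fin m, i.val), G ξ =
      m.factorial * ∑ᶠ l ∈ {l : Ptn | l.size = N ∧ l.length ≤ m}, G (l.beads m) := by
  classical
  rw [finsum_mem_eq_of_bijOn _ (Ptn.bijOn_beads m N) (g := G) fun l _ => rfl,
    finsum_mem_coe_finset, Finset.mul_sum]
  have hfact (ξ : Fin m → ℕ) :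
      (m.factorial : ℚ) * G ξ = ∑ σ : Equiv.Perm (Fin m), G (ξ ∘ σ) := by
    simp [hperm, Fintype.card_perm]
  simp only [hfact]
  rw [← Finset.sum_product']
  symm
  refine Finset.sum_of_injOn (fun p => p.1 ∘ p.2) ?_ ?_ ?_ fun _ _ => rfl
  · rintro ⟨ξ, σ⟩ h ⟨ξ', σ'⟩ h' heq
    simp only [Finset.coe_product, Finset.coe_filter, Set.mem_prod, Set.mem_ofPred_eq] at h h' heq
    obtain rfl : ξ = ξ' := by
      rw [← StrictMono.range_inj h.1.2 h'.1.2, ← σ.surjective.range_comp ξ, heq,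
        σ'.surjective.range_comp ξ']
    have : σ = σ' := Equiv.ext fun i => h.1.2.injective (congrFun heq i)
    rw [this]
  · rintro ⟨ξ, σ⟩ h
    simp only [Finset.coe_product, Finset.coe_filter, Set.mem_prod, Set.mem_ofPred_eq,
      Finset.mem_piAntidiag] at h
    simp [Equiv.sum_comp σ ξ, h.1.1.1]
  · intro ξ hξ hnot
    refine hinj ξ fun hξinj => hnot ?_
    refine ⟨(ξ ∘ Tuple.sort ξ, (Tuple.sort ξ).symm), ?_, ?_⟩
    · have hmono : StrictMono (ξ ∘ Tuple.sort ξ) :=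
        (Tuple.monotone_sort ξ).strictMono_of_injective
          (hξinj.comp (Tuple.sort ξ).injective)
      have hsum := Equiv.sum_comp (Tuple.sort ξ) ξ
      simp only [Finset.mem_piAntidiag] at hξ
      simp [hmono, hsum, hξ.1]
    · funext i
      simp

/-! ### Multiplying by a power sum is adjoint to skewing -/

theorem sum_mul_hall_hDet_X_mul {m N k : ℕ} (hN : N ≤ m) (hk : k + 1 ≤ N) (H : SymF →ₗ[ℚ] ℚ)
    (g : SymF) :
    ∑ ξ ∈ (Finset.univ : Finset (Fin m)).piAntidiag (N + ∑ i : Fin m, i.val),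
        H (hDet fun i => (ξ i : ℤ)) * hall (hDet fun i => (ξ i : ℤ)) (X k * g) =
      ∑ ξ ∈ (Finset.univ : Finset (Fin m)).piAntidiag (N - (k + 1) + ∑ i : Fin m, i.val),
        H (X k * hDet fun i => (ξ i : ℤ)) * hall (hDet fun i => (ξ i : ℤ)) g := by
  have hleft (ξ : Fin m → ℕ) :
      H (hDet fun i => (ξ i : ℤ)) * hall (hDet fun i => (ξ i : ℤ)) (X k * g) =
        ∑ l, H (hDet fun i => (ξ i : ℤ)) *
          hall (hDet ((fun i => (ξ i : ℤ)) - Pi.single l ((k : ℤ) + 1))) g := by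
    rw [hall_X_mul, skewPower_hDet, ← hallLeft_apply, map_sum, Finset.mul_sum]
    rfl
  have hright (ξ : Fin m → ℕ)
      (hξ : ξ ∈ Finset.univ.piAntidiag (N - (k + 1) + ∑ i : Fin m, i.val)) :
      H (X k * hDet fun i => (ξ i : ℤ)) * hall (hDet fun i => (ξ i : ℤ)) g =
        ∑ l, H (hDet ((fun i => (ξ i : ℤ)) + Pi.single l ((k : ℤ) + 1))) *
          hall (hDet fun i => (ξ i : ℤ)) g := by
    rw [X_mul_hDet, map_sum, Finset.sum_mul]
    · exact fun i => Int.natCast_nonneg _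
    · have hsum : ∑ i, ξ i = _ := (Finset.mem_piAntidiag.mp hξ).1
      have : ∑ i, ξ i + (k + 1) ≤ ∑ i : Fin m, i.val + m := by omega
      exact_mod_cast this
  have hadd (ξ : Fin m → ℕ) (l : Fin m) :
      (fun i => (((ξ + Pi.single l (k + 1) : Fin m → ℕ) i : ℕ) : ℤ)) =
        (fun i => (ξ i : ℤ)) + Pi.single l ((k : ℤ) + 1) := by
    funext i
    rcases eq_or_ne i l with rfl | hi
    · simp
    · simp [hi]
  simp only [hleft]
  rw [Finset.sum_congr rfl hright, Finset.sum_comm, eq_comm, Finset.sum_comm]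
  refine Finset.sum_congr rfl fun l _ => ?_
  refine Finset.sum_of_injOn (fun ξ => ξ + Pi.single l (k + 1))
    (add_left_injective _).injOn ?_ ?_ ?_
  · intro ξ hξ
    have hξ : ∑ i, ξ i = _ := (Finset.mem_piAntidiag.mp hξ).1
    refine Finset.mem_piAntidiag.mpr ⟨?_, fun i _ => Finset.mem_univ i⟩
    simp only [Pi.add_apply, Finset.sum_add_distrib, hξ, Finset.mem_univ,
      if_true, Pi.single_apply, Finset.sum_ite_eq']
    omega
  · intro ξ hξ hnot
    have hξ : ∑ i, ξ i = _ := (Finset.mem_piAntidiag.mp hξ).1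
    have hlt : ξ l < k + 1 := by
      by_contra! hle
      have heq : ξ - Pi.single l (k + 1) + Pi.single l (k + 1) = ξ := by
        refine tsub_add_cancel_of_le fun i => ?_
        rcases eq_or_ne i l with rfl | hi
        · simpa using hle
        · simp [hi]
      refine hnot ⟨ξ - Pi.single l (k + 1), ?_, heq⟩
      refine Finset.mem_piAntidiag.mpr ⟨?_, fun i _ => Finset.mem_univ i⟩
      have hsum := congrArg (fun η : Fin m → ℕ => ∑ i, η i) heq
      simp only [Pi.add_apply, Finset.sum_add_distrib, Pi.single_apply, Finset.sum_ite_eq',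
        Finset.mem_univ, if_true] at hsum
      change ∑ i, (ξ - Pi.single l (k + 1) : Fin m → ℕ) i = _
      omega
    have hneg : ((fun i => (ξ i : ℤ)) - Pi.single l ((k : ℤ) + 1) : Fin m → ℤ) l < 0 := by
      simp only [Pi.sub_apply, Pi.single_eq_same]
      omega
    rw [hDet_of_neg hneg, ← hallLeft_apply (0 : SymF), map_zero, mul_zero]
  · intro ξ _
    rw [hadd, add_sub_cancel_right]

theorem finsum_mul_hall_schur_X_mul {N k : ℕ} (hk : k + 1 ≤ N) {H : SymF →ₗ[ℚ] ℚ}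
    (hH : ∀ f, H (X k * f) = 0) (g : SymF) :
    ∑ᶠ l ∈ {l : Ptn | l.size = N}, H (schur l) * hall (schur l) (X k * g) = 0 := by
  set G : (Fin N → ℕ) → ℚ := fun ξ =>
    H (hDet fun i => (ξ i : ℤ)) * hall (hDet fun i => (ξ i : ℤ)) (X k * g) with hG
  have hset : {l : Ptn | l.size = N} = {l | l.size = N ∧ l.length ≤ N} := by
    ext l
    exact ⟨fun h => ⟨h, l.length_le_size.trans_eq h⟩, fun h => h.1⟩
  have hsum := sum_piAntidiag_eq_factorial_mul_finsum N (G := G) ?_ ?_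
  · rw [sum_mul_hall_hDet_X_mul le_rfl hk, Finset.sum_eq_zero fun ξ _ => by rw [hH, zero_mul],
      eq_comm, mul_eq_zero, or_iff_right (Nat.cast_ne_zero.mpr N.factorial_ne_zero)] at hsum
    rw [hset, ← hsum]
    exact finsum_mem_congr rfl fun l hl => by rw [hG, schur_eq_hDet hl.2]
  · intro ξ σ
    have h := hDet_comp_perm (fun i => (ξ i : ℤ)) σ
    rw [hG]
    simp only [Function.comp_def] at h ⊢
    rw [h, ← hallLeft_apply, ← hallLeft_apply]
    rcases Int.units_eq_one_or (Equiv.Perm.sign σ) with hs | hs <;> simp [hs]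
  · intro ξ hξ
    rw [Function.not_injective_iff] at hξ
    obtain ⟨a, b, hab, hne⟩ := hξ
    rw [hG]
    simp only
    rw [hDet_of_eq hne (by rw [hab]), map_zero, zero_mul]

theorem Ptn.exists_eq_scaleP {r n : ℕ} (hr : 0 < r) {ρ : Ptn} (hρ : ρ.size = r * n)
    (hdvd : ∀ a ∈ ρ.parts, r ∣ a) : ∃ σ : Ptn, σ.size = n ∧ ρ = scaleP r σ := by
  have hmap : (ρ.parts.map (· / r)).map (fun a => r * a) = ρ.parts := by
    rw [Multiset.map_map]
    conv_rhs => rw [← Multiset.map_id ρ.parts]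
    exact Multiset.map_congr rfl fun a ha => Nat.mul_div_cancel' (hdvd a ha)
  refine ⟨⟨ρ.parts.map (· / r), fun x hx => ?_⟩, ?_, ?_⟩
  · obtain ⟨a, ha, rfl⟩ := Multiset.mem_map.mp hx
    exact Nat.div_pos (Nat.le_of_dvd (ρ.pos a ha) (hdvd a ha)) hr
  · refine Nat.eq_of_mul_eq_mul_left hr ?_
    rw [← hρ, Ptn.size, Ptn.size, ← Multiset.sum_map_mul_left]
    simpa using congrArg Multiset.sum hmap
  · refine Ptn.ext_parts ?_
    rw [scaleP, hmap, Ptn.parts_of, Multiset.filter_eq_self.mpr ρ.pos]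

/-- The orthogonality step in the second proof of Proposition 6.2: with
`ℓ_{λμ} = δ_r(μ) LR^λ_{μ[0],…,μ[r-1]}`, for every partition `λ` of `n` and every
partition `ρ` of `rn` not of the form `rσ` with `σ ⊢ n`,
`Σ_{μ ⊢ rn, μ^{c(r)} = ∅} ℓ_{λμ} χ^μ(ρ) = 0`. -/
theorem stmt11 (r n : ℕ) (hr : 2 ≤ r) (hn : 1 ≤ n) (lam ρ : Ptn)
    (hlam : lam.size = n) (hρ : ρ.size = r * n)
    (hnot : ¬ ∃ σ : Ptn, σ.size = n ∧ ρ = scaleP r σ) :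
    ∑ᶠ μ ∈ {μ : Ptn | μ.size = r * n ∧ coreP r μ = Ptn.empty},
        ((rSign r μ : ℚ) * LRmulti lam r (quotP r μ)) * chi μ ρ = 0 := by
  have hr0 : 0 < r := by omega
  obtain ⟨a, ha, hra⟩ : ∃ a ∈ ρ.parts, ¬ r ∣ a := by
    by_contra! h
    exact hnot (Ptn.exists_eq_scaleP hr0 hρ h)
  have hapos := ρ.pos a ha
  have hasize : a - 1 + 1 ≤ r * n := by
    rw [← hρ, Nat.sub_add_cancel hapos]
    exact Multiset.single_le_sum (fun _ _ => Nat.zero_le _) a ha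
  have hpMult : pMult ρ.parts = X (a - 1) * pMult (ρ.parts.erase a) := by
    conv_lhs => rw [← Multiset.cons_erase ha, pMult, Multiset.map_cons, Multiset.prod_cons]
    rfl
  have hzero (f : SymF) :
      (hallLeft (schur lam) ∘ₗ (plethAdj r).toLinearMap) (X (a - 1) * f) = 0 := by
    have hX : plethAdj r (X (a - 1)) = 0 := by
      rw [plethAdj, aeval_X, Nat.sub_add_cancel hapos, if_neg hra]
    rw [LinearMap.comp_apply, AlgHom.toLinearMap_apply, map_mul, hX, zero_mul, map_zero]
  rw [← finsum_mul_hall_schur_X_mul hasize hzero (pMult (ρ.parts.erase a)), ← hpMult]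
  refine finsum_congr fun μ => ?_
  by_cases hcore : coreP r μ = Ptn.empty
  · simp only [Set.mem_ofPred_eq, hcore, and_true]
    rw [LinearMap.comp_apply, AlgHom.toLinearMap_apply, plethAdj_schur hr0 hcore,
      ← zsmul_eq_mul (_ : SymF), map_zsmul, zsmul_eq_mul]
    rfl
  · simp [hcore, plethAdj_schur_of_core_ne hr0 hcore]
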